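/- Let A be a unital C*-algebra, φ a state on A, and (x_i)_{i≥1} a sequence of selfadjoint elements of A such that for every n ≥ 1 the joint distribution of (x₁,…,x_n) with respect to φ is invariant under the linear coaction of 𝓑_s(n). Then for every m ≥ 1 and all positive integers k₁,…,k_m: φ(x_{i₁}^{k₁}·x_{i₂}^{k₂}⋯x_{i_m}^{k_m}) = φ(x_{j₁}^{k₁}·x_{j₂}^{k₂}⋯x_{j_m}^{k_m}) whenever both index tuples (i₁,…,i_m) and (j₁,…,j_m) have consecutive entries distinct (i₁ ≠ i₂, …, i_{m−1} ≠ i_m and j₁ ≠ j₂, …, j_{m−1} ≠ j_m). -/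

import Mathlib

open scoped ComplexOrder

universe u

/-- The family `(u_{ij}, P)` satisfies the defining relations of the boolean permutation
quantum semigroup `𝓑_s(n)`. -/
def BsRel {C : Type u} [Ring C] [StarRing C] {n : ℕ} (u : Fin n → Fin n → C) (P : C) : Prop :=
  (∀ i j, star (u i j) = u i j) ∧
  (∀ i j, u i j * u i j = u i j) ∧
  (∀ i k l, k ≠ l → u i k * u i l = 0) ∧
  (∀ i k l, k ≠ l → u k i * u l i = 0) ∧
  star P = P ∧ P * P = P ∧
  (∀ i, (∑ k, u k i) * P = P)

/-- Invariance of the joint distribution of `(x₁,…,x_n)` with respect to `φ` under the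
linear coaction of `𝓑_s(n)`. -/
def BsLinInvariant {A : Type*} [Ring A] [Algebra ℂ A] {n : ℕ}
    (φ : A →ₗ[ℂ] ℂ) (x : Fin n → A) : Prop :=
  ∀ (C : Type u) [NormedRing C] [StarRing C] [CStarRing C] [NormedAlgebra ℂ C]
    [CompleteSpace C] (u : Fin n → Fin n → C) (P : C), BsRel u P →
    ∀ (m : ℕ) (i : Fin (m + 1) → Fin n),
      φ ((List.ofFn fun t => x (i t)).prod) • P =
        ∑ j : Fin (m + 1) → Fin n,
          φ ((List.ofFn fun t => x (j t)).prod) •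
            (P * (List.ofFn fun t => u (j t) (i t)).prod * P)


lemma bs_vectors (n : ℕ) (hn : 2 ≤ n) : ∃ (f : Fin n → Fin n → EuclideanSpace ℂ (ULift.{u} (Fin n × Fin n))) (w : EuclideanSpace ℂ (ULift.{u} (Fin n × Fin n))) (s a : ℂ),
    (∀ k i l j, inner ℂ (f k i) (f l j) = if k = l then (if i = j then 1 else 0) else (if i = j then 0 else a)) ∧ (∀ k i, inner ℂ (f k i) w = s) ∧ inner ℂ w w = (1:ℂ) ∧ ∀ i, ∑ k, s • f k i = w := by
  have hn0 : (n:ℝ) ≠ 0 := by positivity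
  have hn1 : (0:ℝ) < (n:ℝ) - 1 := by
    have : (2:ℝ) ≤ n := by exact_mod_cast hn
    linarith
  obtain ⟨c, hc⟩ : ∃ c : ℝ, n * n * (c * c) = 1 / n := ⟨√(1 / n) / n, by
    have := Real.mul_self_sqrt (show (0:ℝ) ≤ 1 / n by positivity)
    field_simp at this ⊢
    linarith⟩
  obtain ⟨d, hd⟩ : ∃ d : ℝ, d * d = n / (n - 1) := ⟨√(n / (n - 1)), Real.mul_self_sqrt (by positivity)⟩
  let α : Fin n → Fin n → ℝ := fun k p => (if k = p then 1 else 0) - 1 / n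
  have hα : ∀ k, ∑ p, α k p = 0 := by
    intro k; simp [α, Finset.sum_sub_distrib, hn0]
  have hα' : ∀ p, ∑ k, α k p = 0 := by
    intro k; simp [α, Finset.sum_sub_distrib, hn0]
  have hαα : ∀ k l, ∑ p, α k p * α l p = (if k = l then 1 else 0) - 1 / n := by
    intro k l
    have : ∀ p, α k p * α l p = (if k = p then α l p else 0) - 1 / n * α l p := by
      intro p; simp only [α]; split_ifs <;> ring
    simp only [this, Finset.sum_sub_distrib, ← Finset.mul_sum, hα]
    simp [α, eq_comm]
  have key : ∀ g h : Fin n × Fin n → ℝ, inner ℂ (WithLp.toLp 2 (fun p : ULift.{u} (Fin n × Fin n) => (g p.down : ℂ))) (WithLp.toLp 2 (fun p : ULift.{u} (Fin n × Fin n) => (h p.down : ℂ))) = ((∑ p, ∑ q, g (p,q) * h (p,q) : ℝ) : ℂ) := by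
    intro g h
    rw [PiLp.inner_apply, ← Fintype.sum_prod_type (f := fun p : Fin n × Fin n => g p * h p), ← Equiv.sum_comp (Equiv.ulift.{u} : ULift.{u} (Fin n × Fin n) ≃ _)]
    push_cast
    refine Finset.sum_congr rfl fun p _ => ?_
    simp [mul_comm]
  let F : Fin n → Fin n → Fin n × Fin n → ℝ := fun k i p => c + d * (α k p.1 * α i p.2)
  refine ⟨fun k i => WithLp.toLp 2 (fun p => (F k i p.down : ℂ)), WithLp.toLp 2 (fun p => ((fun _ => 1 / n : Fin n × Fin n → ℝ) p.down : ℂ)), ((n * c : ℝ) : ℂ), ((1 / (n - 1) : ℝ) : ℂ), ?_, ?_, ?_, ?_⟩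
  · intro k i l j
    rw [key]
    have h1 : ∀ p q, F k i (p, q) * F l j (p, q) = c * c + c * d * (α k p * α i q)
        + c * d * (α l p * α j q) + d * d * ((α k p * α l p) * (α i q * α j q)) := by
      intro p q; simp only [F]; ring
    have h2 : ∑ p, ∑ q, F k i (p, q) * F l j (p, q) = n * n * (c * c)
        + d * d * (((if k = l then 1 else 0) - 1 / n) * ((if i = j then 1 else 0) - 1 / n)) := by
      simp only [h1, Finset.sum_add_distrib, ← Finset.mul_sum, ← Finset.sum_mul, hα, hαα]
      simp
      ring
    rw [h2, hc, hd]
    have h3 := hn1.ne'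
    have h4 : ((1 / (n:ℝ) + n / (n - 1) * (((if k = l then 1 else 0) - 1 / n) * ((if i = j then 1 else 0) - 1 / n)) : ℝ)) = if k = l then (if i = j then 1 else 0) else (if i = j then 0 else 1 / ((n:ℝ) - 1)) := by
      split_ifs <;> field_simp <;> ring
    rw [h4]
    split_ifs <;> simp
  · intro k i
    rw [key (F k i) (fun _ => 1 / n)]
    simp only [F, add_mul, Finset.sum_add_distrib, ← Finset.mul_sum, ← Finset.sum_mul, hα]
    simp
    field_simp
  · rw [key (fun _ => 1 / n) (fun _ => 1 / n)]
    simp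
    field_simp
  · intro i
    have h5 : ∀ q : Fin n × Fin n, ∑ k, (n * c) * F k i q = 1 / n := by
      intro q
      simp only [F, ← Finset.mul_sum, ← Finset.sum_mul, Finset.sum_add_distrib, hα']
      simp
      simp at hc
      linarith
    ext p
    have h6 := congrArg (fun r : ℝ => (r : ℂ)) (h5 p.down)
    simp only [Complex.ofReal_sum, Complex.ofReal_mul] at h6
    simpa using h6

open InnerProductSpace in
lemma bs_prod {n : ℕ} {E : Type*} [NormedAddCommGroup E] [InnerProductSpace ℂ E]
    (f : Fin n → Fin n → E) (w : E) (s a : ℂ)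
    (hf : ∀ k i l j, inner ℂ (f k i) (f l j) = if k = l then (if i = j then 1 else 0) else (if i = j then 0 else a))
    (hw : ∀ k i, inner ℂ (f k i) w = s) :
    ∀ (m : ℕ) (j i i' : Fin (m + 1) → Fin n)
      (_ : ∀ t : Fin m, i t.castSucc = i t.succ ↔ i' t.castSucc = i' t.succ),
      ∃ c : ℂ, (List.ofFn fun t => rankOne ℂ (f (j t) (i t)) (f (j t) (i t))).prod w = c • f (j 0) (i 0)
       ∧ (List.ofFn fun t => rankOne ℂ (f (j t) (i' t)) (f (j t) (i' t))).prod w = c • f (j 0) (i' 0) := by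
  intro m
  induction m with
  | zero => intro j i i' _; exact ⟨s, by simp [hw]⟩
  | succ m ih =>
    intro j i i' h
    obtain ⟨c, h1, h2⟩ := ih (fun t => j t.succ) (fun t => i t.succ) (fun t => i' t.succ)
      (fun t => by simpa using h t.succ)
    refine ⟨c * inner ℂ (f (j 0) (i 0)) (f (j 1) (i 1)), ?_, ?_⟩
    · rw [List.ofFn_succ, List.prod_cons, mul_apply_eq_comp, h1]
      simp [mul_smul]
    · rw [List.ofFn_succ, List.prod_cons, mul_apply_eq_comp, h2]
      have h0 : i 0 = i 1 ↔ i' 0 = i' 1 := by simpa using h 0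
      simp [hf, h0, mul_smul]

set_option maxHeartbeats 2000000 in
open InnerProductSpace in
lemma bs_fin {A : Type u} [Ring A] [Algebra ℂ A] (φ : A →ₗ[ℂ] ℂ) (n : ℕ) (hn : 2 ≤ n)
    (x : Fin n → A) (hinv : BsLinInvariant.{u} φ x) (m : ℕ) (i i' : Fin (m + 1) → Fin n)
    (h : ∀ t : Fin m, i t.castSucc = i t.succ ↔ i' t.castSucc = i' t.succ) :
    φ ((List.ofFn fun t => x (i t)).prod) = φ ((List.ofFn fun t => x (i' t)).prod) := by
  obtain ⟨f, w, s, a, hf, hw, hww, hsum⟩ := bs_vectors.{u} n hn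
  have hw0 : w ≠ 0 := by rintro rfl; simp at hww
  have hR : BsRel (fun k i => rankOne ℂ (f k i) (f k i)) (rankOne ℂ w w) := by
    refine ⟨?_, ?_, ?_, ?_, ?_, ?_, ?_⟩
    · intro i j; simp [ContinuousLinearMap.star_eq_adjoint]
    · intro i j
      rw [ContinuousLinearMap.mul_def, comp_rankOne, rankOne_apply, hf]
      simp
    · intro i k l hkl; simp [ContinuousLinearMap.mul_def, comp_rankOne, hf, hkl]
    · intro i k l hkl; simp [ContinuousLinearMap.mul_def, comp_rankOne, hf, hkl]
    · simp [ContinuousLinearMap.star_eq_adjoint]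
    · rw [ContinuousLinearMap.mul_def, comp_rankOne, rankOne_apply, hww, one_smul]
    · intro i
      rw [ContinuousLinearMap.mul_def, comp_rankOne]
      simp [hw, hsum]
  have e1 := hinv _ _ _ hR m i
  have e2 := hinv _ _ _ hR m i'
  have e3 : (φ ((List.ofFn fun t => x (i t)).prod)) • rankOne ℂ w w =
      (φ ((List.ofFn fun t => x (i' t)).prod)) • rankOne ℂ w w := by
    rw [e1, e2]
    refine Finset.sum_congr rfl fun j _ => ?_
    obtain ⟨c, h1, h2⟩ := bs_prod f w s a hf hw m j i i' h
    have hs : ∀ k i, inner ℂ w (f k i) = starRingEnd ℂ s := by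
      intro k i; rw [← hw k i, inner_conj_symm]
    congr 1
    simp only [ContinuousLinearMap.mul_def, comp_rankOne, ContinuousLinearMap.comp_apply]
    rw [h1, h2]
    simp [inner_smul_right, hs]
  exact smul_left_injective ℂ (rankOne_ne_zero hw0 hw0) e3

lemma bs_nat {A : Type u} [Ring A] [Algebra ℂ A] (φ : A →ₗ[ℂ] ℂ)
    (x : ℕ → A) (hinv : ∀ n : ℕ, BsLinInvariant.{u} φ fun t : Fin n => x t)
    (m : ℕ) (i i' : Fin (m + 1) → ℕ)
    (h : ∀ t : Fin m, i t.castSucc = i t.succ ↔ i' t.castSucc = i' t.succ) :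
    φ ((List.ofFn fun t => x (i t)).prod) = φ ((List.ofFn fun t => x (i' t)).prod) := by
  let n := (∑ t, i t) + (∑ t, i' t) + 2
  have h1 : ∀ t, i t < n := fun t => by
    have := Finset.single_le_sum (f := i) (fun _ _ => Nat.zero_le _) (Finset.mem_univ t)
    simp only [n]; omega
  have h2 : ∀ t, i' t < n := fun t => by
    have := Finset.single_le_sum (f := i') (fun _ _ => Nat.zero_le _) (Finset.mem_univ t)
    simp only [n]; omega
  exact bs_fin φ n (by simp [n]) _ (hinv n) m (fun t => ⟨i t, h1 t⟩) (fun t => ⟨i' t, h2 t⟩)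
    (fun t => by simpa using h t)

lemma bs_list {A : Type u} [Ring A] [Algebra ℂ A] (φ : A →ₗ[ℂ] ℂ)
    (x : ℕ → A) (hinv : ∀ n : ℕ, BsLinInvariant.{u} φ fun t : Fin n => x t)
    (L : List (ℕ × ℕ)) (h : L.IsChain fun a b => a.1 = b.1 ↔ a.2 = b.2) :
    φ ((L.map fun a => x a.1).prod) = φ ((L.map fun a => x a.2).prod) := by
  obtain ⟨m, g, rfl⟩ : ∃ (m : ℕ) (g : Fin m → ℕ × ℕ), L = List.ofFn g :=
    ⟨L.length, L.get, (List.ofFn_get L).symm⟩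
  cases m with
  | zero => simp
  | succ m =>
    rw [List.map_ofFn, List.map_ofFn]
    refine bs_nat φ x hinv m (fun t => (g t).1) (fun t => (g t).2) fun t => ?_
    rw [List.isChain_iff_getElem] at h
    have := h t (by simp)
    simp only [List.getElem_ofFn] at this
    exact this

theorem stmt11 {A : Type u} [NormedRing A] [StarRing A] [CStarRing A] [NormedAlgebra ℂ A]
    [CompleteSpace A]
    (φ : A →ₗ[ℂ] ℂ) (hpos : ∀ a : A, 0 ≤ φ (star a * a)) (hone : φ 1 = 1)
    (x : ℕ → A) (hsa : ∀ i, star (x i) = x i)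
    (hinv : ∀ n : ℕ, BsLinInvariant.{u} φ fun t : Fin n => x t)
    (m : ℕ) (k : Fin (m + 1) → ℕ) (hk : ∀ t, 1 ≤ k t)
    (i j : Fin (m + 1) → ℕ)
    (hnei : ∀ t : Fin m, i t.castSucc ≠ i t.succ)
    (hnej : ∀ t : Fin m, j t.castSucc ≠ j t.succ) :
    φ ((List.ofFn fun t => x (i t) ^ k t).prod) =
      φ ((List.ofFn fun t => x (j t) ^ k t).prod) := by
  have key := bs_list φ x hinv (List.ofFn fun t => List.replicate (k t) (i t, j t)).flatten (by
    have hk' : ∀ t, k t ≠ 0 := fun t => by have := hk t; omega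
    rw [List.isChain_flatten (by simp [List.mem_ofFn, hk'])]
    constructor
    · intro l hl
      rw [List.mem_ofFn] at hl
      obtain ⟨t, rfl⟩ := hl
      exact List.isChain_replicate_of_rel _ (by simp)
    · rw [List.isChain_iff_getElem]
      intro t ht
      have ht' : t < m := by simpa using ht
      have h1 := hnei ⟨t, ht'⟩
      have h2 := hnej ⟨t, ht'⟩
      simp only [Fin.castSucc_mk, Fin.succ_mk] at h1 h2
      simp [List.getLast?_replicate, List.head?_replicate, hk', h1, h2, List.getElem_ofFn, -List.ofFn_succ])
  simpa [List.map_flatten, List.prod_flatten, List.map_ofFn, Function.comp_def] using key
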